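/- arXiv:2601.02257 — 2 statements merged into one kernel-verified Lean document; each statement's English description precedes it below -/
import Mathlib

section
/- Let b, D, k, T be integers with 3 ≤ b ≤ T and 1 ≤ D ≤ k ≤ T/b, let h = ⌈log_b T⌉, and let p ≥ 1 be real. Then D^p · ⌊k/D⌋ · (⌊log_b(DT/k)⌋ − 1/b) ≤ sens_p(R̂_b, S_{D,k})^p ≤ D^p · ⌈k/D⌉ · (⌈log_b(DT/k)⌉ + 2). -/
/-- `Δ ∈ S_D`: every interval sum of `Δ` is bounded by `D` in absolute value. -/
def memS (T D : ℕ) (Δ : Fin T → ℤ) : Prop :=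
  ∀ i j : Fin T, i ≤ j → |∑ t ∈ Finset.Icc i j, Δ t| ≤ (D : ℤ)

/-- The sensitivity vector set `S_{D,k}`. -/
def SDk (T D k : ℕ) : Set (Fin T → ℤ) :=
  {Δ | memS T D Δ ∧ (∑ t, |Δ t|) ≤ (k : ℤ)}

/-- The ℓp norm of a finite real vector. -/
noncomputable def pnorm (p : ℝ) {ι : Type} [Fintype ι] (x : ι → ℝ) : ℝ :=
  (∑ i, |x i| ^ p) ^ (1 / p)

/-- `sens_p(R, S)`: the maximum of `‖RΔ‖_p` over `Δ ∈ S`. -/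
noncomputable def sens (p : ℝ) {ι : Type} [Fintype ι] {T : ℕ}
    (R : Matrix ι (Fin T) ℝ) (S : Set (Fin T → ℤ)) : ℝ :=
  sSup ((fun Δ => pnorm p (R.mulVec fun t => (Δ t : ℝ))) '' S)

/-- The reduced-tree matrix `R̂_b` of the complete `b`-ary tree of height `h`,
restricted to its first `T` columns: entry `1` iff the node `(ℓ, j)` is counted
(the root, or not the left-most child of its parent) and leaf `t` lies in its
subtree. Rows are indexed by node coordinates `(ℓ, j)`; rows whose coordinates
do not correspond to a tree node are identically zero. -/
def nodeMatrixHatT (b h T : ℕ) : Matrix (Fin (h + 1) × Fin (b ^ h)) (Fin T) ℝ :=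
  fun q t =>
    if ((q.1 : ℕ) = h ∨ (q.2 : ℕ) % b ≠ 0) ∧
        (q.2 : ℕ) * b ^ (q.1 : ℕ) ≤ (t : ℕ) ∧ (t : ℕ) < ((q.2 : ℕ) + 1) * b ^ (q.1 : ℕ) then 1
    else 0

/-- The row sum of node `(l, j)`, with natural number indices. -/
def rowS (b h T : ℕ) (Δ : Fin T → ℤ) (l j : ℕ) : ℤ :=
  if l = h ∨ j % b ≠ 0 then
    ∑ t : Fin T, if j * b ^ l ≤ (t : ℕ) ∧ (t : ℕ) < (j + 1) * b ^ l then Δ t else 0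
  else 0

/-- Row sums of the matrix are the integer row sums. -/
lemma mulVec_eq_rowS (b h T : ℕ) (Δ : Fin T → ℤ) (q : Fin (h + 1) × Fin (b ^ h)) :
    (nodeMatrixHatT b h T).mulVec (fun t => (Δ t : ℝ)) q
      = ((rowS b h T Δ q.1 q.2 : ℤ) : ℝ) := by
  unfold rowS nodeMatrixHatT Matrix.mulVec dotProduct
  by_cases hc : (q.1 : ℕ) = h ∨ (q.2 : ℕ) % b ≠ 0
  · simp only [hc, true_and, if_true]
    push_cast
    apply Finset.sum_congr rfl
    intro t _
    split_ifs <;> simp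
  · simp [hc]

/-- The `p`-th power sum as a double sum over ranges. -/
lemma sum_eq_range (b h T : ℕ) (Δ : Fin T → ℤ) (p : ℝ) :
    ∑ q, |(nodeMatrixHatT b h T).mulVec (fun t => (Δ t : ℝ)) q| ^ p
      = ∑ l ∈ Finset.range (h + 1), ∑ j ∈ Finset.range (b ^ h),
          |((rowS b h T Δ l j : ℤ) : ℝ)| ^ p := by
  simp_rw [mulVec_eq_rowS]
  rw [Fintype.sum_prod_type,
    ← Fin.sum_univ_eq_sum_range (fun l => ∑ j ∈ Finset.range (b ^ h),
          |((rowS b h T Δ l j : ℤ) : ℝ)| ^ p)]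
  apply Finset.sum_congr rfl
  intro l _
  rw [← Fin.sum_univ_eq_sum_range (fun j => |((rowS b h T Δ l j : ℤ) : ℝ)| ^ p)]

lemma rowS_abs_le (b h T D : ℕ) (Δ : Fin T → ℤ) (hΔ : memS T D Δ) (l j : ℕ) :
    |rowS b h T Δ l j| ≤ (D : ℤ) := by
  unfold rowS
  split_ifs with hc
  · rw [← Finset.sum_filter]
    by_cases hne : (Finset.univ.filter (fun t : Fin T =>
        j * b ^ l ≤ (t : ℕ) ∧ (t : ℕ) < (j + 1) * b ^ l)).Nonempty
    · set s := Finset.univ.filter (fun t : Fin T =>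
        j * b ^ l ≤ (t : ℕ) ∧ (t : ℕ) < (j + 1) * b ^ l) with hs
      have heq : s = Finset.Icc (s.min' hne) (s.max' hne) := by
        ext x
        constructor
        · intro hx
          exact Finset.mem_Icc.2 ⟨s.min'_le x hx, s.le_max' x hx⟩
        · intro hx
          have h1 := s.min'_mem hne
          have h2 := s.max'_mem hne
          rw [Finset.mem_Icc] at hx
          have h3 : ((s.min' hne : Fin T) : ℕ) ≤ x := hx.1
          have h4 : (x : ℕ) ≤ (s.max' hne : Fin T) := hx.2
          generalize s.min' hne = u at *
          generalize s.max' hne = v at *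
          rw [hs, Finset.mem_filter] at *
          refine ⟨Finset.mem_univ _, le_trans h1.2.1 h3, lt_of_le_of_lt h4 h2.2.2⟩
      rw [heq]
      exact hΔ _ _ (s.min'_le _ (s.max'_mem hne))
    · rw [Finset.not_nonempty_iff_eq_empty] at hne
      rw [hne]; simp
  · simp

lemma rowS_sum_le (b h T k : ℕ) (hb : 0 < b) (Δ : Fin T → ℤ)
    (hΔ : (∑ t, |Δ t|) ≤ (k : ℤ)) (l n : ℕ) :
    ∑ j ∈ Finset.range n, |rowS b h T Δ l j| ≤ (k : ℤ) := by
  have h1 : ∀ j ∈ Finset.range n, |rowS b h T Δ l j| ≤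
      ∑ t : Fin T, if j = (t : ℕ) / b ^ l then |Δ t| else 0 := by
    intro j _
    unfold rowS
    split_ifs with hc
    · refine (Finset.abs_sum_le_sum_abs _ _).trans (Finset.sum_le_sum ?_)
      intro t _
      by_cases h2 : j * b ^ l ≤ (t : ℕ) ∧ (t : ℕ) < (j + 1) * b ^ l
      · have : j = (t : ℕ) / b ^ l := by
          symm
          exact Nat.div_eq_of_lt_le h2.1 h2.2
        rw [if_pos h2, if_pos this]
      · rw [if_neg h2]
        split_ifs <;> simp
    · rw [abs_zero]
      apply Finset.sum_nonneg
      intro t _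
      split_ifs <;> simp
  refine (Finset.sum_le_sum h1).trans ?_
  rw [Finset.sum_comm]
  refine le_trans (Finset.sum_le_sum ?_) hΔ
  intro t _
  rw [Finset.sum_ite_eq']
  split_ifs <;> simp

/-- Number of nodes at level `l` meeting the first `T` leaves. -/
def cnt (b h T l : ℕ) : ℕ := ((Finset.range (b ^ h)).filter (fun j => j * b ^ l < T)).card

/-- Number of these nodes that are not left-most children. -/
def cntR (b h T l : ℕ) : ℕ :=
  ((Finset.range (b ^ h)).filter (fun j => j * b ^ l < T ∧ j % b ≠ 0)).card

lemma cnt_succ (b h T l : ℕ) (hb : 0 < b) (hT : T ≤ b ^ h) :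
    cntR b h T l + cnt b h T (l + 1) ≤ cnt b h T l := by
  have h1 : cnt b h T (l + 1) ≤
      ((Finset.range (b ^ h)).filter (fun j => j * b ^ l < T ∧ ¬ (j % b ≠ 0))).card := by
    unfold cnt
    apply Finset.card_le_card_of_injOn (fun j => j * b)
    · intro j hj
      simp only [Finset.coe_filter, Finset.mem_range, Set.mem_setOf_eq] at hj ⊢
      have e : j * b * b ^ l = j * b ^ (l + 1) := by ring
      refine ⟨?_, by rw [e]; exact hj.2, by simp⟩
      have : j * b ≤ j * b * b ^ l := Nat.le_mul_of_pos_right _ (pow_pos hb l)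
      omega
    · intro x _ y _ hxy
      exact Nat.eq_of_mul_eq_mul_right hb hxy
  have h2 := Finset.card_filter_add_card_filter_not
    (s := (Finset.range (b ^ h)).filter (fun j => j * b ^ l < T)) (fun j => j % b ≠ 0)
  rw [Finset.filter_filter, Finset.filter_filter] at h2
  unfold cntR
  have h3 : ((Finset.range (b ^ h)).filter (fun j => j * b ^ l < T)).card = cnt b h T l := rfl
  omega

lemma pow_abs_le (D : ℕ) (p : ℝ) (hp : 1 ≤ p) (z : ℤ) (hz : |z| ≤ (D : ℤ)) :
    |(z : ℝ)| ^ p ≤ (D : ℝ) ^ p := by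
  apply Real.rpow_le_rpow (abs_nonneg _) _ (by linarith)
  exact_mod_cast hz

lemma pow_abs_le' (D : ℕ) (p : ℝ) (hp : 1 ≤ p) (z : ℤ) (hz : |z| ≤ (D : ℤ)) :
    |(z : ℝ)| ^ p ≤ (D : ℝ) ^ (p - 1) * ((|z| : ℤ) : ℝ) := by
  have h1 : |(z : ℝ)| ≤ D := by exact_mod_cast hz
  have h2 : |(z : ℝ)| ^ p = |(z : ℝ)| ^ (p - 1) * |(z : ℝ)| := by
    conv_lhs => rw [show p = (p - 1) + 1 by ring]
    rw [Real.rpow_add_one' (abs_nonneg _) (by linarith)]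
  rw [h2, Int.cast_abs]
  exact mul_le_mul_of_nonneg_right
    (Real.rpow_le_rpow (abs_nonneg _) h1 (by linarith)) (abs_nonneg _)

lemma rowS_zero (b h T : ℕ) (Δ : Fin T → ℤ) (l j : ℕ)
    (hj : ¬ (j * b ^ l < T ∧ (l = h ∨ j % b ≠ 0))) : rowS b h T Δ l j = 0 := by
  unfold rowS
  split_ifs with hc
  · apply Finset.sum_eq_zero
    intro t _
    have : (t : ℕ) < T := t.2
    rw [if_neg]
    rintro ⟨h1, _⟩
    exact hj ⟨by omega, hc⟩
  · rfl

lemma level_bound (b h T D : ℕ) (p : ℝ) (hp : 1 ≤ p) (Δ : Fin T → ℤ) (hΔ : memS T D Δ)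
    (l : ℕ) (q : ℕ → Prop) [DecidablePred q]
    (hq : ∀ j, (j * b ^ l < T ∧ (l = h ∨ j % b ≠ 0)) → q j) :
    ∑ j ∈ Finset.range (b ^ h), |((rowS b h T Δ l j : ℤ) : ℝ)| ^ p ≤
      (D : ℝ) ^ p * (((Finset.range (b ^ h)).filter q).card : ℝ) := by
  have : ∀ j ∈ Finset.range (b ^ h), |((rowS b h T Δ l j : ℤ) : ℝ)| ^ p ≤
      if q j then (D : ℝ) ^ p else 0 := by
    intro j _
    split_ifs with h1
    · exact pow_abs_le D p hp _ (rowS_abs_le b h T D Δ hΔ l j)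
    · rw [rowS_zero b h T Δ l j (fun h2 => h1 (hq j h2))]
      simp [Real.zero_rpow (by linarith : p ≠ 0)]
  refine (Finset.sum_le_sum this).trans ?_
  rw [← Finset.sum_filter, Finset.sum_const, nsmul_eq_mul, mul_comm]

lemma tail_bound (b h T D : ℕ) (hb : 0 < b) (hT : T ≤ b ^ h) (p : ℝ) (hp : 1 ≤ p)
    (Δ : Fin T → ℤ) (hΔ : memS T D Δ) (n : ℕ) : ∀ L : ℕ, L + n = h →
    ∑ l ∈ Finset.Ico L (h + 1), ∑ j ∈ Finset.range (b ^ h),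
      |((rowS b h T Δ l j : ℤ) : ℝ)| ^ p ≤ (D : ℝ) ^ p * (cnt b h T L : ℝ) := by
  induction n with
  | zero =>
    intro L hL
    have : L = h := by omega
    subst this
    rw [Nat.Ico_succ_singleton, Finset.sum_singleton]
    exact level_bound b L T D p hp Δ hΔ L _ (fun j hj => hj.1)
  | succ n ih =>
    intro L hL
    rw [Finset.sum_eq_sum_Ico_succ_bot (by omega)]
    have h1 := ih (L + 1) (by omega)
    have h2 := level_bound b h T D p hp Δ hΔ L (fun j => j * b ^ L < T ∧ j % b ≠ 0)
      (fun j hj => ⟨hj.1, hj.2.resolve_left (by omega)⟩)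
    have h3 : (cntR b h T L : ℝ) + cnt b h T (L + 1) ≤ cnt b h T L := by
      exact_mod_cast cnt_succ b h T L hb hT
    have h4 : (0 : ℝ) ≤ (D : ℝ) ^ p := by positivity
    have h5 := mul_le_mul_of_nonneg_left h3 h4
    rw [mul_add] at h5
    unfold cntR at h5
    linarith

lemma cnt_le (b h T D k L : ℕ) (hb : 0 < b) (hD : 1 ≤ D) (hL : D * T ≤ k * b ^ L) :
    cnt b h T L ≤ (k + D - 1) / D := by
  unfold cnt
  rw [← Finset.card_range ((k + D - 1) / D)]
  apply Finset.card_le_card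
  intro j hj
  rw [Finset.mem_filter] at hj
  rw [Finset.mem_range, Nat.lt_iff_add_one_le, Nat.le_div_iff_mul_le (by omega)]
  have h1 : (j * D) * b ^ L < k * b ^ L := by nlinarith [hj.2]
  have h2 := lt_of_mul_lt_mul_right h1 (Nat.zero_le _)
  have h3 : (j + 1) * D = j * D + D := by ring
  omega

lemma upper_core (b h T D k L : ℕ) (hb : 0 < b) (hD : 1 ≤ D) (hT : T ≤ b ^ h) (hLh : L ≤ h)
    (hL : D * T ≤ k * b ^ L) (p : ℝ) (hp : 1 ≤ p) (Δ : Fin T → ℤ) (hΔ : Δ ∈ SDk T D k) :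
    ∑ q, |(nodeMatrixHatT b h T).mulVec (fun t => (Δ t : ℝ)) q| ^ p ≤
      (D : ℝ) ^ p * (((k + D - 1) / D : ℕ) : ℝ) * ((L : ℝ) + 2) := by
  rw [sum_eq_range, Finset.range_eq_Ico, ← Finset.sum_Ico_consecutive _ (Nat.zero_le L)
    (by omega : L ≤ h + 1), ← Finset.range_eq_Ico]
  have h1 := tail_bound b h T D hb hT p hp Δ hΔ.1 (h - L) L (by omega)
  have hc : (cnt b h T L : ℝ) ≤ (((k + D - 1) / D : ℕ) : ℝ) := by
    exact_mod_cast cnt_le b h T D k L hb hD hL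
  set C : ℝ := (((k + D - 1) / D : ℕ) : ℝ) with hC
  have hC0 : 0 ≤ C := by positivity
  have hDp : (0 : ℝ) ≤ (D : ℝ) ^ p := by positivity
  have hkC : (k : ℝ) ≤ D * C := by
    rw [hC]
    have : k ≤ D * ((k + D - 1) / D) := by
      have e1 := Nat.div_add_mod (k + D - 1) D
      have e2 := Nat.mod_lt (k + D - 1) (by omega : D > 0)
      omega
    exact_mod_cast this
  have h2 : ∀ l ∈ Finset.range L, ∑ j ∈ Finset.range (b ^ h),
      |((rowS b h T Δ l j : ℤ) : ℝ)| ^ p ≤ (D : ℝ) ^ p * C := by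
    intro l _
    have e1 : ∑ j ∈ Finset.range (b ^ h), |((rowS b h T Δ l j : ℤ) : ℝ)| ^ p ≤
        ∑ j ∈ Finset.range (b ^ h), (D : ℝ) ^ (p - 1) * ((|rowS b h T Δ l j| : ℤ) : ℝ) :=
      Finset.sum_le_sum (fun j _ =>
        pow_abs_le' D p hp _ (rowS_abs_le b h T D Δ hΔ.1 l j))
    rw [← Finset.mul_sum] at e1
    have e2 : ∑ j ∈ Finset.range (b ^ h), ((|rowS b h T Δ l j| : ℤ) : ℝ) ≤ (k : ℝ) := by
      exact_mod_cast rowS_sum_le b h T k hb Δ hΔ.2 l (b ^ h)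
    have e3 : (0 : ℝ) ≤ (D : ℝ) ^ (p - 1) := by positivity
    have e4 : (D : ℝ) ^ p = (D : ℝ) ^ (p - 1) * D := by
      conv_lhs => rw [show p = (p - 1) + 1 by ring]
      rw [Real.rpow_add_one' (by positivity) (by linarith)]
    calc _ ≤ _ := e1
      _ ≤ (D : ℝ) ^ (p - 1) * (D * C) := mul_le_mul_of_nonneg_left (e2.trans hkC) e3
      _ = _ := by rw [e4]; ring
  have h3 := Finset.sum_le_sum h2
  rw [Finset.sum_const, Finset.card_range, nsmul_eq_mul] at h3
  have h4 := mul_le_mul_of_nonneg_left hc hDp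
  have h5 := mul_nonneg hDp hC0
  linarith

/-- Geometric sum `1 + b + ... + b^(s-1)`. -/
def gs (b s : ℕ) : ℕ := ∑ u ∈ Finset.range s, b ^ u

lemma gs_lt (b s : ℕ) (hb : 2 ≤ b) : gs b s < b ^ s := Nat.geomSum_lt hb (by simp)

lemma gs_split (b L l : ℕ) (hl : l ≤ L) : gs b L = gs b (L - l) * b ^ l + gs b l := by
  unfold gs
  obtain ⟨s, rfl⟩ := Nat.exists_eq_add_of_le hl
  rw [Finset.sum_range_add, Nat.add_sub_cancel_left, Finset.sum_mul, add_comm]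
  congr 1
  apply Finset.sum_congr rfl
  intro u _
  ring

lemma gs_mod (b s : ℕ) (hb : 2 ≤ b) (hs : 1 ≤ s) (i : ℕ) :
    (i * b ^ s + gs b s) % b = 1 := by
  obtain ⟨s, rfl⟩ := Nat.exists_eq_add_of_le hs
  have h1 := gs_split b (1 + s) 1 (by omega)
  have h2 : gs b 1 = 1 := by simp [gs]
  rw [h1, h2, show i * b ^ (1 + s) + (gs b (1 + s - 1) * b ^ 1 + 1)
    = 1 + (i * b ^ s + gs b (1 + s - 1)) * b by ring, Nat.add_mul_mod_self_right]
  exact Nat.mod_eq_of_lt (by omega)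

/-- Number of marked leaves before `n`. -/
def mk (b L m n : ℕ) : ℕ :=
  ((Finset.range m).filter (fun i => i * b ^ L + gs b L < n)).card

/-- Prefix sums of the lower bound vector. -/
def pre (b L m D n : ℕ) : ℤ := if mk b L m n % 2 = 1 then (D : ℤ) else 0

/-- The lower bound vector. -/
def low (b L m D T : ℕ) (t : Fin T) : ℤ := pre b L m D (t + 1) - pre b L m D t

lemma low_sum (b L m D T x y : ℕ) (hxy : x ≤ y) (hy : y ≤ T) :
    (∑ t : Fin T, if x ≤ (t : ℕ) ∧ (t : ℕ) < y then low b L m D T t else 0)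
      = pre b L m D y - pre b L m D x := by
  unfold low
  rw [Fin.sum_univ_eq_sum_range (fun t => if x ≤ t ∧ t < y then
    pre b L m D (t + 1) - pre b L m D t else 0), ← Finset.sum_filter]
  have : (Finset.range T).filter (fun t => x ≤ t ∧ t < y) = Finset.Ico x y := by
    ext t; simp only [Finset.mem_filter, Finset.mem_range, Finset.mem_Ico]; omega
  rw [this, Finset.sum_Ico_sub _ hxy]

lemma mk_mono (b L m : ℕ) {x y : ℕ} (hxy : x ≤ y) : mk b L m x ≤ mk b L m y := by
  apply Finset.card_le_card
  intro i hi
  rw [Finset.mem_filter] at *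
  exact ⟨hi.1, by omega⟩

lemma pre_sub_abs (b L m D : ℕ) (x y : ℕ) : |pre b L m D y - pre b L m D x| ≤ (D : ℤ) := by
  unfold pre
  split_ifs <;> simp

lemma low_mem (b L m D T k : ℕ) (hm : m * D ≤ k) : low b L m D T ∈ SDk T D k := by
  constructor
  · intro i j hij
    have h1 := low_sum b L m D T i (j + 1) (by have : (i : ℕ) ≤ j := hij; omega) j.2
    rw [← Finset.sum_filter] at h1
    have h2 : Finset.univ.filter (fun t : Fin T => (i : ℕ) ≤ t ∧ (t : ℕ) < j + 1)
        = Finset.Icc i j := by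
      ext t
      simp only [Finset.mem_filter, Finset.mem_univ, true_and, Finset.mem_Icc, Fin.le_def]
      omega
    rw [h2] at h1
    rw [h1]
    exact pre_sub_abs _ _ _ _ _ _
  · have h1 : ∀ n : ℕ, |pre b L m D (n + 1) - pre b L m D n| ≤
        (D : ℤ) * mk b L m (n + 1) - (D : ℤ) * mk b L m n := by
      intro n
      have h2 := mk_mono b L m (Nat.le_succ n)
      rcases Nat.eq_or_lt_of_le h2 with h3 | h3
      · unfold pre
        rw [Nat.succ_eq_add_one] at h3
        rw [h3]; simp
      · refine (pre_sub_abs _ _ _ _ _ _).trans ?_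
        rw [Nat.succ_eq_add_one] at h3
        have h4 : (mk b L m n : ℤ) + 1 ≤ mk b L m (n + 1) := by exact_mod_cast h3
        have h5 : (0 : ℤ) ≤ D := by positivity
        nlinarith
    unfold low
    rw [Fin.sum_univ_eq_sum_range (fun t => |pre b L m D (t + 1) - pre b L m D t|)]
    refine (Finset.sum_le_sum (fun n _ => h1 n)).trans ?_
    rw [Finset.sum_range_sub (fun n => (D : ℤ) * mk b L m n)]
    have h6 : mk b L m T ≤ m := by
      unfold mk
      exact (Finset.card_filter_le _ _).trans (by simp)
    have h7 : D * mk b L m T ≤ k := by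
      refine le_trans ?_ hm
      rw [mul_comm m D]
      exact Nat.mul_le_mul_left D h6
    have h8 : (D : ℤ) * mk b L m T ≤ k := by exact_mod_cast h7
    have h9 : (0 : ℤ) ≤ (D : ℤ) * mk b L m 0 := by positivity
    linarith

lemma mk_eq (b L m n i : ℕ) (hi : i ≤ m)
    (h1 : ∀ i' < i, i' * b ^ L + gs b L < n)
    (h2 : ∀ i', i ≤ i' → n ≤ i' * b ^ L + gs b L) : mk b L m n = i := by
  unfold mk
  have : (Finset.range m).filter (fun i => i * b ^ L + gs b L < n) = Finset.range i := by
    ext x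
    simp only [Finset.mem_filter, Finset.mem_range]
    constructor
    · rintro ⟨_, hx⟩
      by_contra hc
      have := h2 x (by omega)
      omega
    · intro hx
      exact ⟨by omega, h1 x hx⟩
  rw [this, Finset.card_range]

lemma low_row (b h L m D T : ℕ) (hb : 2 ≤ b) (hmT : m * b ^ L ≤ T) (l i : ℕ)
    (hl : l < L) (hi : i < m) :
    |rowS b h T (low b L m D T) l (i * b ^ (L - l) + gs b (L - l))| = (D : ℤ) := by
  set j := i * b ^ (L - l) + gs b (L - l) with hj
  have hg := gs_split b L l hl.le
  have hpw : b ^ (L - l) * b ^ l = b ^ L := by rw [← pow_add]; congr 1; omega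
  have hgl := gs_lt b l hb
  have hgL := gs_lt b L hb
  have hgd := gs_lt b (L - l) hb
  have e1 : j * b ^ l = i * b ^ L + gs b (L - l) * b ^ l := by
    rw [hj, add_mul, mul_assoc, hpw]
  have e2 : (j + 1) * b ^ l = j * b ^ l + b ^ l := by ring
  have e3 : (gs b (L - l) + 1) * b ^ l ≤ b ^ L := by
    rw [← hpw]; exact Nat.mul_le_mul_right _ hgd
  have e3' : (gs b (L - l) + 1) * b ^ l = gs b (L - l) * b ^ l + b ^ l := by ring
  have e4 : (i + 1) * b ^ L ≤ m * b ^ L := Nat.mul_le_mul_right _ hi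
  have e4' : (i + 1) * b ^ L = i * b ^ L + b ^ L := by ring
  have m1 : mk b L m (j * b ^ l) = i := by
    apply mk_eq _ _ _ _ _ hi.le
    · intro i' hi'
      have f1 : (i' + 1) * b ^ L ≤ i * b ^ L := Nat.mul_le_mul_right _ hi'
      have f2 : (i' + 1) * b ^ L = i' * b ^ L + b ^ L := by ring
      omega
    · intro i' hi'
      have f1 : i * b ^ L ≤ i' * b ^ L := Nat.mul_le_mul_right _ hi'
      omega
  have m2 : mk b L m ((j + 1) * b ^ l) = i + 1 := by
    apply mk_eq _ _ _ _ _ hi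
    · intro i' hi'
      have f1 : i' * b ^ L ≤ i * b ^ L := Nat.mul_le_mul_right _ (by omega)
      omega
    · intro i' hi'
      have f1 : (i + 1) * b ^ L ≤ i' * b ^ L := Nat.mul_le_mul_right _ hi'
      omega
  have hmod : j % b = 1 := gs_mod b (L - l) hb (by omega) i
  unfold rowS
  rw [if_pos (Or.inr (by omega)), low_sum _ _ _ _ _ _ _ (by omega) (by omega)]
  unfold pre
  rw [m1, m2]
  rcases Nat.mod_two_eq_zero_or_one i with h0 | h0
  · have : (i + 1) % 2 = 1 := by omega
    simp [h0, this]
  · have : (i + 1) % 2 = 0 := by omega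
    simp [h0, this]

lemma lower_core (b h L m D T : ℕ) (hb : 2 ≤ b) (hT : T ≤ b ^ h) (hLh : L ≤ h)
    (hmT : m * b ^ L ≤ T) (p : ℝ) :
    (D : ℝ) ^ p * (m : ℝ) * (L : ℝ) ≤
      ∑ q, |(nodeMatrixHatT b h T).mulVec (fun t => (low b L m D T t : ℝ)) q| ^ p := by
  rw [sum_eq_range]
  have hnn : ∀ l j : ℕ, 0 ≤ |((rowS b h T (low b L m D T) l j : ℤ) : ℝ)| ^ p :=
    fun l j => by positivity
  have h1 : ∀ l ∈ Finset.range L, (D : ℝ) ^ p * (m : ℝ) ≤ ∑ j ∈ Finset.range (b ^ h),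
      |((rowS b h T (low b L m D T) l j : ℤ) : ℝ)| ^ p := by
    intro l hl
    rw [Finset.mem_range] at hl
    have hinj : Set.InjOn (fun i => i * b ^ (L - l) + gs b (L - l))
        (Finset.range m : Set ℕ) := by
      intro x _ y _ hxy
      have : x * b ^ (L - l) = y * b ^ (L - l) := by
        simpa using hxy
      exact Nat.eq_of_mul_eq_mul_right (pow_pos (by omega) _) this
    have hsub : (Finset.range m).image (fun i => i * b ^ (L - l) + gs b (L - l)) ⊆
        Finset.range (b ^ h) := by
      intro j hj
      rw [Finset.mem_image] at hj
      obtain ⟨i, hi, rfl⟩ := hj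
      rw [Finset.mem_range] at *
      have hgd := gs_lt b (L - l) hb
      have e1 : (i + 1) * b ^ (L - l) ≤ m * b ^ L :=
        Nat.mul_le_mul hi (Nat.pow_le_pow_right (by omega) (by omega))
      have e2 : (i + 1) * b ^ (L - l) = i * b ^ (L - l) + b ^ (L - l) := by ring
      omega
    refine le_trans ?_ (Finset.sum_le_sum_of_subset_of_nonneg hsub (fun j _ _ => hnn l j))
    rw [Finset.sum_image hinj]
    have h2 : ∀ i ∈ Finset.range m, |((rowS b h T (low b L m D T) l
        (i * b ^ (L - l) + gs b (L - l)) : ℤ) : ℝ)| ^ p = (D : ℝ) ^ p := by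
      intro i hi
      rw [← Int.cast_abs, low_row b h L m D T hb hmT l i hl (Finset.mem_range.1 hi)]
      simp
    rw [Finset.sum_congr rfl h2, Finset.sum_const, Finset.card_range, nsmul_eq_mul, mul_comm]
  have hsub : Finset.range L ⊆ Finset.range (h + 1) := by
    intro x hx
    rw [Finset.mem_range] at *
    omega
  refine le_trans ?_ (Finset.sum_le_sum_of_subset_of_nonneg hsub
    (fun l _ _ => Finset.sum_nonneg (fun j _ => hnn l j)))
  refine le_trans ?_ (Finset.sum_le_sum h1)
  rw [Finset.sum_const, Finset.card_range, nsmul_eq_mul, mul_comm]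

lemma pnorm_rpow {ι : Type} [Fintype ι] (p : ℝ) (hp : 1 ≤ p) (x : ι → ℝ) :
    pnorm p x ^ p = ∑ i, |x i| ^ p := by
  unfold pnorm
  rw [← Real.rpow_mul (Finset.sum_nonneg (fun i _ => by positivity)),
    one_div_mul_cancel (by linarith), Real.rpow_one]

lemma pnorm_nonneg {ι : Type} [Fintype ι] (p : ℝ) (x : ι → ℝ) : 0 ≤ pnorm p x := by
  unfold pnorm
  positivity

theorem stmt18 (b T D k : ℕ) (hb : 3 ≤ b) (hbT : b ≤ T) (hD : 1 ≤ D) (hDk : D ≤ k)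
    (hkT : b * k ≤ T) (p : ℝ) (hp : 1 ≤ p)
    (h : ℕ) (hh : h = Nat.clog b T) :
    (D : ℝ) ^ p * ((k / D : ℕ) : ℝ) *
        ((⌊Real.logb (b : ℝ) ((D : ℝ) * (T : ℝ) / (k : ℝ))⌋ : ℝ) - 1 / (b : ℝ)) ≤
      sens p (nodeMatrixHatT b h T) (SDk T D k) ^ p ∧
    sens p (nodeMatrixHatT b h T) (SDk T D k) ^ p ≤
      (D : ℝ) ^ p * (((k + D - 1) / D : ℕ) : ℝ) *
        ((⌈Real.logb (b : ℝ) ((D : ℝ) * (T : ℝ) / (k : ℝ))⌉ : ℝ) + 2) := by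
  have hT : T ≤ b ^ h := by rw [hh]; exact Nat.le_pow_clog (by omega) T
  have hb1 : (1 : ℝ) < b := by exact_mod_cast (by omega : 1 < b)
  have hk0 : (0 : ℝ) < k := by exact_mod_cast (by omega : 0 < k)
  have hD0 : (0 : ℝ) < D := by exact_mod_cast (by omega : 0 < D)
  have hT0 : (0 : ℝ) < T := by exact_mod_cast (by omega : 0 < T)
  set x : ℝ := (D : ℝ) * (T : ℝ) / (k : ℝ) with hx
  have hx0 : 0 < x := by positivity
  have hx1 : 1 ≤ x := by
    rw [hx, le_div_iff₀ hk0]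
    have : 1 * k ≤ D * T := Nat.mul_le_mul hD (by nlinarith)
    exact_mod_cast this
  have hxh : x ≤ (b : ℝ) ^ h := by
    rw [hx, div_le_iff₀ hk0]
    have : D * T ≤ b ^ h * k := by
      rw [mul_comm D T]; exact Nat.mul_le_mul hT hDk
    exact_mod_cast this
  have hy0 : 0 ≤ Real.logb b x := Real.logb_nonneg hb1 hx1
  have hyh : Real.logb b x ≤ h := by
    rw [Real.logb_le_iff_le_rpow hb1 hx0, Real.rpow_natCast]
    exact hxh
  have hbdd : ∀ L : ℕ, L ≤ h → D * T ≤ k * b ^ L → ∀ Δ ∈ SDk T D k,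
      pnorm p ((nodeMatrixHatT b h T).mulVec (fun t => (Δ t : ℝ))) ≤
      ((D : ℝ) ^ p * (((k + D - 1) / D : ℕ) : ℝ) * ((L : ℝ) + 2)) ^ (1 / p) := by
    intro L hLh hL Δ hΔ
    have := upper_core b h T D k L (by omega) hD hT hLh hL p hp Δ hΔ
    unfold pnorm
    exact Real.rpow_le_rpow (Finset.sum_nonneg (fun i _ => by positivity)) this (by positivity)
  constructor
  · set L := ⌊Real.logb b x⌋₊ with hLdef
    have hfl : ((⌊Real.logb b x⌋ : ℤ) : ℝ) = (L : ℝ) := by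
      rw [hLdef, natCast_floor_eq_intCast_floor hy0]
    rw [hfl]
    have hLh : L ≤ h := Nat.floor_le_of_le hyh
    have hLx : (b : ℝ) ^ L ≤ x := by
      have := Nat.floor_le hy0
      rw [← hLdef, Real.le_logb_iff_rpow_le hb1 hx0, Real.rpow_natCast] at this
      exact this
    have hmT : (k / D) * b ^ L ≤ T := by
      rw [hx, le_div_iff₀ hk0] at hLx
      have e1 : b ^ L * k ≤ D * T := by exact_mod_cast hLx
      have e2 : D * (k / D) ≤ k := Nat.mul_div_le k D
      have e3 : D * ((k / D) * b ^ L) ≤ D * T := by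
        calc D * ((k / D) * b ^ L) = (D * (k / D)) * b ^ L := by ring
          _ ≤ k * b ^ L := Nat.mul_le_mul_right _ e2
          _ = b ^ L * k := mul_comm _ _
          _ ≤ _ := e1
      exact Nat.le_of_mul_le_mul_left e3 (by omega)
    have h1 := lower_core b h L (k / D) D T (by omega) hT hLh hmT p
    have hmem := low_mem b L (k / D) D T k (Nat.div_mul_le_self k D)
    have hDT : D * T ≤ k * b ^ h := Nat.mul_le_mul hDk hT
    have h2 : pnorm p ((nodeMatrixHatT b h T).mulVec
        (fun t => (low b L (k / D) D T t : ℝ))) ≤ sens p (nodeMatrixHatT b h T) (SDk T D k) := by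
      unfold sens
      apply le_csSup
      · refine ⟨((D : ℝ) ^ p * (((k + D - 1) / D : ℕ) : ℝ) * ((h : ℝ) + 2)) ^ (1 / p), ?_⟩
        rintro _ ⟨Δ, hΔ, rfl⟩
        exact hbdd h le_rfl hDT Δ hΔ
      · exact ⟨_, hmem, rfl⟩
    have h3 := Real.rpow_le_rpow (pnorm_nonneg p _) h2 (by linarith : 0 ≤ p)
    rw [pnorm_rpow p hp] at h3
    refine le_trans (le_trans ?_ h1) h3
    apply mul_le_mul_of_nonneg_left _ (by positivity)
    have : (0 : ℝ) ≤ 1 / (b : ℝ) := by positivity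
    linarith
  · set L := ⌈Real.logb b x⌉₊ with hLdef
    have hcl : ((⌈Real.logb b x⌉ : ℤ) : ℝ) = (L : ℝ) := by
      rw [hLdef, natCast_ceil_eq_intCast_ceil hy0]
    rw [hcl]
    have hLh : L ≤ h := Nat.ceil_le.2 hyh
    have hLx : x ≤ (b : ℝ) ^ L := by
      have := Nat.le_ceil (Real.logb b x)
      rw [← hLdef, Real.logb_le_iff_le_rpow hb1 hx0, Real.rpow_natCast] at this
      exact this
    have hL : D * T ≤ k * b ^ L := by
      rw [hx, div_le_iff₀ hk0] at hLx
      rw [mul_comm k]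
      exact_mod_cast hLx
    set B : ℝ := (D : ℝ) ^ p * (((k + D - 1) / D : ℕ) : ℝ) * ((L : ℝ) + 2) with hB
    have hB0 : 0 ≤ B := by positivity
    have h1 : sens p (nodeMatrixHatT b h T) (SDk T D k) ≤ B ^ (1 / p) := by
      unfold sens
      apply Real.sSup_le
      · rintro _ ⟨Δ, hΔ, rfl⟩
        exact hbdd L hLh hL Δ hΔ
      · positivity
    have h0 : 0 ≤ sens p (nodeMatrixHatT b h T) (SDk T D k) := by
      unfold sens
      apply Real.sSup_nonneg
      rintro _ ⟨Δ, hΔ, rfl⟩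
      exact pnorm_nonneg p _
    have h2 := Real.rpow_le_rpow h0 h1 (by linarith : 0 ≤ p)
    rwa [← Real.rpow_mul hB0, one_div_mul_cancel (by linarith), Real.rpow_one] at h2
end

section
/- Let b ≥ 2 and h ≥ 1 be integers and let 0 ≤ t ≤ b^h − 1. Then the minimum cardinality of a set Q of pairwise-disjoint nodes of T_{b,h} whose union of leaf intervals equals {0, 1, …, t} is the sum of the digits of t+1 written in base b. -/
/-- The leaf interval `v_{ℓ,j} = {j·b^ℓ, …, (j+1)·b^ℓ − 1}` of node `q = (ℓ, j)`. -/
def iv (b : ℕ) (q : ℕ × ℕ) : Finset ℕ :=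
  Finset.Ico (q.2 * b ^ q.1) ((q.2 + 1) * b ^ q.1)

theorem ds_step (b n : ℕ) (hb : 2 ≤ b) :
    (Nat.digits b n).sum = n % b + (Nat.digits b (n / b)).sum := by
  rcases Nat.eq_zero_or_pos n with rfl | hn
  · simp
  · rw [Nat.digits_def' (by omega) hn]; simp

theorem ds_mul (b n : ℕ) (hb : 2 ≤ b) :
    (Nat.digits b (n * b)).sum = (Nat.digits b n).sum := by
  rw [ds_step b (n * b) hb, Nat.mul_mod_left, Nat.mul_div_cancel _ (by omega)]; simp

theorem ds_split (b m r : ℕ) (hb : 2 ≤ b) (hr : r < b) :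
    (Nat.digits b (m * b + r)).sum = r + (Nat.digits b m).sum := by
  have e1 : (m * b + r) % b = r := by
    rw [Nat.add_comm, Nat.add_mul_mod_self_right, Nat.mod_eq_of_lt hr]
  have e2 : (m * b + r) / b = m := by
    rw [Nat.add_comm, Nat.add_mul_div_right _ _ (by omega), Nat.div_eq_of_lt hr, Nat.zero_add]
  rw [ds_step b _ hb, e1, e2]

theorem ds_succ (b : ℕ) (hb : 2 ≤ b) (n : ℕ) :
    (Nat.digits b (n + 1)).sum ≤ (Nat.digits b n).sum + 1 := by
  induction n using Nat.strong_induction_on with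
  | _ n ih =>
    have hlt : n % b < b := Nat.mod_lt _ (by omega)
    have e : n = n / b * b + n % b := (Nat.div_add_mod' n b).symm
    have h1 := ds_step b n hb
    by_cases hc : n % b + 1 < b
    · have := ds_split b (n / b) (n % b + 1) hb hc
      rw [← Nat.add_assoc, ← e] at this
      omega
    · have hn : 0 < n := by
        rcases Nat.eq_zero_or_pos n with rfl | hn
        · simp at hc; omega
        · exact hn
      have h2 := ih (n / b) (Nat.div_lt_self hn (by omega))
      have e2 : n + 1 = (n / b + 1) * b := by
        rw [Nat.add_mul]; omega
      rw [e2, ds_mul _ _ hb]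
      omega

theorem ds_pow (b : ℕ) (hb : 2 ≤ b) (k n : ℕ) :
    (Nat.digits b (n + b ^ k)).sum ≤ (Nat.digits b n).sum + 1 := by
  induction k generalizing n with
  | zero => simpa using ds_succ b hb n
  | succ k ih =>
    have hlt : n % b < b := Nat.mod_lt _ (by omega)
    have e : n = n / b * b + n % b := (Nat.div_add_mod' n b).symm
    have e2 : n + b ^ (k + 1) = (n / b + b ^ k) * b + n % b := by
      rw [pow_succ, Nat.add_mul]; omega
    rw [e2, ds_split _ _ _ hb hlt, ds_step b n hb]
    have := ih (n / b)
    omega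

theorem ds_last (b : ℕ) (hb : 2 ≤ b) (n : ℕ) (hn : 0 < n) :
    ∃ k m, n = (m + 1) * b ^ k ∧
      (Nat.digits b n).sum = (Nat.digits b (m * b ^ k)).sum + 1 := by
  induction n using Nat.strong_induction_on with
  | _ n ih =>
    have hlt : n % b < b := Nat.mod_lt _ (by omega)
    have e : n = n / b * b + n % b := (Nat.div_add_mod' n b).symm
    by_cases hc : n % b = 0
    · have hp : 0 < n / b := by
        rcases Nat.eq_zero_or_pos (n / b) with h0 | h0
        · rw [h0] at e; omega
        · exact h0
      obtain ⟨k, m, h1, h2⟩ := ih (n / b) (Nat.div_lt_self hn (by omega)) hp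
      refine ⟨k + 1, m, ?_, ?_⟩
      · rw [pow_succ, ← Nat.mul_assoc, ← h1]; omega
      · rw [pow_succ, ← Nat.mul_assoc, ds_mul _ _ hb, ← h2, ds_step b n hb, hc, Nat.zero_add]
    · refine ⟨0, n - 1, by simp; omega, ?_⟩
      have := ds_split b (n / b) (n % b - 1) hb (by omega)
      have e3 : n / b * b + (n % b - 1) = n - 1 := by omega
      rw [e3] at this
      simp only [pow_zero, Nat.mul_one]
      rw [this, ds_step b n hb]; omega

theorem ds_exists (b : ℕ) (hb : 2 ≤ b) (n : ℕ) :
    ∃ Q : Finset (ℕ × ℕ),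
      (∀ q ∈ Q, ∀ q' ∈ Q, q ≠ q' → Disjoint (iv b q) (iv b q')) ∧
      Q.biUnion (iv b) = Finset.range n ∧ Q.card = (Nat.digits b n).sum := by
  induction n using Nat.strong_induction_on with
  | _ n ih =>
    rcases Nat.eq_zero_or_pos n with rfl | hn
    · exact ⟨∅, by simp, by simp, by simp⟩
    obtain ⟨k, m, h1, h2⟩ := ds_last b hb n hn
    have hp : 0 < b ^ k := Nat.pow_pos (by omega)
    have hlt : m * b ^ k < n := by rw [h1, Nat.add_mul]; omega
    obtain ⟨Q, hd, hu, hcard⟩ := ih _ hlt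
    have hiv : iv b (k, m) = Finset.Ico (m * b ^ k) n := by simp [iv, h1]
    have hdis : ∀ q ∈ Q, Disjoint (iv b q) (iv b (k, m)) := by
      intro q hq
      rw [hiv, Finset.disjoint_left]
      intro x hx hx'
      have : x ∈ Q.biUnion (iv b) := Finset.mem_biUnion.2 ⟨q, hq, hx⟩
      rw [hu, Finset.mem_range] at this
      rw [Finset.mem_Ico] at hx'
      omega
    have hnot : (k, m) ∉ Q := by
      intro hq
      have h3 := hdis _ hq
      rw [disjoint_self, hiv] at h3
      have h4 : m * b ^ k ∈ Finset.Ico (m * b ^ k) n := Finset.mem_Ico.2 ⟨le_rfl, hlt⟩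
      rw [h3] at h4
      simp at h4
    refine ⟨insert (k, m) Q, ?_, ?_, ?_⟩
    · intro q hq q' hq' hne
      rcases Finset.mem_insert.1 hq with rfl | hq <;>
        rcases Finset.mem_insert.1 hq' with rfl | hq'
      · exact absurd rfl hne
      · exact (hdis _ hq').symm
      · exact hdis _ hq
      · exact hd _ hq _ hq' hne
    · rw [Finset.biUnion_insert, hu, hiv]
      ext x
      simp only [Finset.mem_union, Finset.mem_Ico, Finset.mem_range]
      omega
    · rw [Finset.card_insert_of_notMem hnot, hcard, h2]

theorem ds_sum_le (b : ℕ) (hb : 2 ≤ b) (Q : Finset (ℕ × ℕ)) :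
    (Nat.digits b (∑ q ∈ Q, b ^ q.1)).sum ≤ Q.card := by
  induction Q using Finset.induction_on with
  | empty => simp
  | insert a s ha ih =>
    rw [Finset.sum_insert ha, Finset.card_insert_of_notMem ha, Nat.add_comm]
    exact (ds_pow b hb _ _).trans (by omega)

theorem stmt19 (b h t : ℕ) (hb : 2 ≤ b) (hh : 1 ≤ h) (ht : t < b ^ h) :
    IsLeast
      {n : ℕ | ∃ Q : Finset (ℕ × ℕ),
        (∀ q ∈ Q, q.1 ≤ h ∧ q.2 < b ^ (h - q.1)) ∧
        (∀ q ∈ Q, ∀ q' ∈ Q, q ≠ q' → Disjoint (iv b q) (iv b q')) ∧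
        Q.biUnion (iv b) = Finset.range (t + 1) ∧
        Q.card = n}
      ((Nat.digits b (t + 1)).sum) := by
  constructor
  · obtain ⟨Q, hd, hu, hcard⟩ := ds_exists b hb (t + 1)
    refine ⟨Q, ?_, hd, hu, hcard⟩
    rintro ⟨l, j⟩ hq
    have hp : 0 < b ^ l := Nat.pow_pos (by omega)
    have hle : (j + 1) * b ^ l ≤ b ^ h := by
      have hx : (j + 1) * b ^ l - 1 ∈ Q.biUnion (iv b) := by
        refine Finset.mem_biUnion.2 ⟨_, hq, ?_⟩
        simp only [iv, Finset.mem_Ico, Nat.add_mul]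
        omega
      rw [hu, Finset.mem_range] at hx
      omega
    have hl : l ≤ h := by
      have : b ^ l ≤ b ^ h := le_trans (Nat.le_mul_of_pos_left _ (by omega)) hle
      exact (Nat.pow_le_pow_iff_right (by omega)).1 this
    refine ⟨hl, ?_⟩
    have e : b ^ h = b ^ (h - l) * b ^ l := by rw [← pow_add]; congr 1; omega
    rw [e] at hle
    exact Nat.le_of_mul_le_mul_right hle hp
  · rintro n ⟨Q, -, hd, hu, rfl⟩
    have hc : (Q.biUnion (iv b)).card = ∑ q ∈ Q, b ^ q.1 := by
      rw [Finset.card_biUnion hd]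
      refine Finset.sum_congr rfl fun q _ => ?_
      simp [iv, Nat.add_mul]
    rw [hu, Finset.card_range] at hc
    rw [hc]
    exact ds_sum_le b hb Q
end
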